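/- arXiv:2309.00682 — 4 statements merged into one kernel-verified Lean document; each statement's English description precedes it below -/
import Mathlib

section
/- Let K ∈ ℝ^{2×2}. Then the following two properties hold simultaneously: (P1) for all u, u′ ∈ ℝ², if K u = K u′ then u = u′; and (P2) for each j ∈ {1,2} and all u, u′ ∈ ℝ², if u_1 = u′_1 and (K u)_j = (K u′)_j then u_2 = u′_2 — if and only if K is invertible and both entries of the second column of K are nonzero (K_{12} ≠ 0 and K_{22} ≠ 0). -/
open scoped Matrix

/-- The second input is determined by the first input and the `j`-th output exactly when
the corresponding entry of the second column is nonzero. -/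
theorem snd_recoverable_iff (K : Matrix (Fin 2) (Fin 2) ℝ) (j : Fin 2) :
    (∀ u u' : Fin 2 → ℝ, u 0 = u' 0 → (K *ᵥ u) j = (K *ᵥ u') j → u 1 = u' 1) ↔
      K j 1 ≠ 0 := by
  simp only [Matrix.mulVec, dotProduct, Fin.sum_univ_two]
  constructor
  · intro h h0
    simpa [h0] using h ![0, 0] ![0, 1]
  · intro hK u u' h0 h
    rw [h0] at h
    exact mul_left_cancel₀ hK (add_left_cancel h)

/-- Characterization of polarizing 2×2 kernels over the reals
(Lemma 2 of the paper): a kernel `K ∈ ℝ^{2×2}` satisfies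
(P1) the input pair is recoverable from both outputs, and
(P2) given the first input and either single output, the second input is recoverable,
if and only if `K` is invertible and both entries of its second column are nonzero. -/
theorem polarizing_kernel_iff (K : Matrix (Fin 2) (Fin 2) ℝ) :
    ((∀ u u' : Fin 2 → ℝ, K *ᵥ u = K *ᵥ u' → u = u') ∧
      (∀ j : Fin 2, ∀ u u' : Fin 2 → ℝ,
        u 0 = u' 0 → (K *ᵥ u) j = (K *ᵥ u') j → u 1 = u' 1)) ↔
    (IsUnit K ∧ K 0 1 ≠ 0 ∧ K 1 1 ≠ 0) := by
  refine and_congr Matrix.mulVec_injective_iff_isUnit ?_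
  simp only [snd_recoverable_iff, Fin.forall_fin_two]
end

section
/- Let K ∈ ℝ^{3×3}. Then the following three properties hold simultaneously: (a) for all u, u′ ∈ ℝ³, K u = K u′ implies u = u′; (b) for every two-element subset S ⊆ {1,2,3} and all u, u′ ∈ ℝ³, if u_1 = u′_1 and (K u)_s = (K u′)_s for all s ∈ S, then u = u′; (c) for every j ∈ {1,2,3} and all u, u′ ∈ ℝ³, if u_1 = u′_1, u_2 = u′_2 and (K u)_j = (K u′)_j, then u_3 = u′_3 — if and only if: (1) K is invertible; (2) each of the three 2×2 submatrices of K formed by its last two columns and any two of its rows is invertible; and (3) all three entries of the last column of K are nonzero. -/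
open scoped Matrix

theorem isUnit_submatrix_last_two_iff (K : Matrix (Fin 3) (Fin 3) ℝ) (i j : Fin 3) :
    IsUnit (K.submatrix ![i, j] ![1, 2]) ↔
      ∀ u u' : Fin 3 → ℝ, u 0 = u' 0 → (K *ᵥ u) i = (K *ᵥ u') i →
        (K *ᵥ u) j = (K *ᵥ u') j → u = u' := by
  rw [← Matrix.mulVec_injective_iff_isUnit]
  constructor
  · intro h u u' h0 hi hj
    have key : ![u 1, u 2] = ![u' 1, u' 2] := h <| by
      ext k
      fin_cases k <;>
        simp [Matrix.mulVec, dotProduct, Fin.sum_univ_succ] at hi hj ⊢ <;> grind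
    have h1 : u 1 = u' 1 := congrFun key 0
    have h2 : u 2 = u' 2 := congrFun key 1
    ext k
    fin_cases k <;> assumption
  · intro h v w hvw
    have hi := congrFun hvw 0
    have hj := congrFun hvw 1
    have key : ![0, v 0, v 1] = ![0, w 0, w 1] := by
      apply h
      · rfl
      · simpa [Matrix.mulVec, dotProduct, Fin.sum_univ_succ] using hi
      · simpa [Matrix.mulVec, dotProduct, Fin.sum_univ_succ] using hj
    ext k
    fin_cases k
    · exact congrFun key 1
    · exact congrFun key 2

theorem last_entry_ne_zero_iff (K : Matrix (Fin 3) (Fin 3) ℝ) (j : Fin 3) :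
    K j 2 ≠ 0 ↔ ∀ u u' : Fin 3 → ℝ, u 0 = u' 0 → u 1 = u' 1 →
      (K *ᵥ u) j = (K *ᵥ u') j → u 2 = u' 2 := by
  constructor
  · intro hK u u' h0 h1 hj
    simpa [Matrix.mulVec, dotProduct, Fin.sum_univ_three, h0, h1, hK] using hj
  · intro h hK
    have := h ![0, 0, 1] 0 rfl rfl (by simp [Matrix.mulVec, dotProduct, Fin.sum_univ_three, hK])
    simp at this

/-- Characterization of polarizing 3×3 kernels over the reals
(Section II-F.1 of the paper, kernel size 3): properties (a), (b), (c) — sequential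
recoverability of the inputs from suitable subsets of the outputs — hold simultaneously
if and only if `K` is invertible, the three 2×2 submatrices formed by the last two
columns and any two rows are invertible, and all entries of the last column are nonzero. -/
theorem polarizing_kernel_size_three_iff (K : Matrix (Fin 3) (Fin 3) ℝ) :
    ((∀ u u' : Fin 3 → ℝ, K *ᵥ u = K *ᵥ u' → u = u') ∧
      (∀ S : Finset (Fin 3), S.card = 2 → ∀ u u' : Fin 3 → ℝ,
        u 0 = u' 0 → (∀ s ∈ S, (K *ᵥ u) s = (K *ᵥ u') s) → u = u') ∧
      (∀ j : Fin 3, ∀ u u' : Fin 3 → ℝ,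
        u 0 = u' 0 → u 1 = u' 1 → (K *ᵥ u) j = (K *ᵥ u') j → u 2 = u' 2)) ↔
    (IsUnit K ∧
      (∀ i₁ i₂ : Fin 3, i₁ ≠ i₂ → IsUnit (K.submatrix ![i₁, i₂] ![1, 2])) ∧
      (∀ i : Fin 3, K i 2 ≠ 0)) := by
  refine and_congr Matrix.mulVec_injective_iff_isUnit (and_congr ?_ ?_)
  · simp only [isUnit_submatrix_last_two_iff]
    constructor
    · intro h i j hij u u' h0 hi hj
      exact h {i, j} (Finset.card_pair hij) u u' h0 (by simp [hi, hj])
    · intro h S hS u u' h0 hu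
      obtain ⟨i, j, hij, rfl⟩ := Finset.card_eq_two.mp hS
      exact h i j hij u u' h0 (hu i (by simp)) (hu j (by simp))
  · exact forall_congr' fun j => (last_entry_ne_zero_iff K j).symm
end

section
/- Let p ≥ 1 and K ∈ ℝ^{p×p}. Then the following are equivalent: (I) for every j ∈ {0,1,...,p−1}, every subset S ⊆ {1,...,p} with |S| = p − j, and all u, u′ ∈ ℝ^p, if u_i = u′_i for all i ≤ j and (K u)_s = (K u′)_s for all s ∈ S, then u = u′; (II) K is invertible, and for every j ∈ {1,...,p−1}, every (p−j)×(p−j) submatrix of K formed by deleting the first j columns and keeping any p−j of the rows is invertible. -/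
open scoped Matrix

/-- If `d` vanishes outside the range of the injective map `c`, then the rows of `K *ᵥ d` selected
by `r` only involve the columns of `K` selected by `c`. -/
theorem Matrix.submatrix_mulVec_comp_of_eq_zero {R m n ι κ : Type*} [NonUnitalNonAssocSemiring R]
    [Fintype n] [Fintype κ] (K : Matrix m n R) (r : ι → m) {c : κ → n}
    (hc : Function.Injective c) {d : n → R} (hd : ∀ i ∉ Set.range c, d i = 0) :
    K.submatrix r c *ᵥ (d ∘ c) = (K *ᵥ d) ∘ r := by
  ext k
  exact Fintype.sum_of_injective c hc _ _ (fun i hi => by rw [hd i hi, mul_zero]) fun _ => rfl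

/-- A square submatrix of `K` is invertible if and only if the outputs of its rows determine the
inputs of its columns once all the other inputs are known. -/
theorem Matrix.isUnit_submatrix_iff_recoverable {F m n κ : Type*} [Field F] [Fintype n]
    [Fintype κ] [DecidableEq κ] (K : Matrix m n F) (r : κ → m) {c : κ → n}
    (hc : Function.Injective c) :
    IsUnit (K.submatrix r c) ↔
      ∀ u u' : n → F, (∀ i ∉ Set.range c, u i = u' i) →
        (∀ k, (K *ᵥ u) (r k) = (K *ᵥ u') (r k)) → u = u' := by
  rw [← Matrix.mulVec_injective_iff_isUnit]
  constructor
  · intro hinj u u' hu hK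
    have hd : ∀ i ∉ Set.range c, (u - u') i = 0 := fun i hi => sub_eq_zero.2 (hu i hi)
    have hzero : (u - u') ∘ c = 0 := by
      apply hinj
      rw [K.submatrix_mulVec_comp_of_eq_zero r hc hd, Matrix.mulVec_zero, Matrix.mulVec_sub]
      ext k
      exact sub_eq_zero.2 (hK k)
    ext i
    by_cases hi : i ∈ Set.range c
    · obtain ⟨k, rfl⟩ := hi
      exact sub_eq_zero.1 (congrFun hzero k)
    · exact hu i hi
  · intro h v w hvw
    have hext (x : κ → F) :
        K.submatrix r c *ᵥ x = (K *ᵥ Function.extend c x 0) ∘ r := by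
      rw [← K.submatrix_mulVec_comp_of_eq_zero r hc
        (fun i hi => Function.extend_apply' (f := c) x (0 : n → F) i hi), Function.extend_comp hc]
    have heq := h (Function.extend c v 0) (Function.extend c w 0)
      (fun i hi => by
        rw [Function.extend_apply' _ _ _ hi, Function.extend_apply' _ _ _ hi])
      (fun k => by
        simpa only [hext, Function.comp_apply] using congrFun hvw k)
    rw [← Function.extend_comp hc v 0, heq, Function.extend_comp hc]

/-- Characterization of polarizing kernels of arbitrary size
(Section II-F.1 of the paper): the sequential recoverability property (I) — for every
`j` and every set `S` of `p − j` output indices, the first `j` inputs together with the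
outputs in `S` determine all inputs — holds if and only if (II) `K` is invertible and
every square submatrix obtained by deleting the first `j` columns (`1 ≤ j ≤ p−1`) and
keeping any `p − j` rows is invertible. -/
theorem polarizing_kernel_arbitrary_size_iff (p : ℕ) (hp : 1 ≤ p)
    (K : Matrix (Fin p) (Fin p) ℝ) :
    (∀ j : ℕ, j < p → ∀ S : Finset (Fin p), S.card = p - j →
      ∀ u u' : Fin p → ℝ, (∀ i : Fin p, (i : ℕ) < j → u i = u' i) →
        (∀ s ∈ S, (K *ᵥ u) s = (K *ᵥ u') s) → u = u') ↔
    (IsUnit K ∧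
      ∀ j : ℕ, 1 ≤ j → j < p → ∀ S : Finset (Fin p), (hS : S.card = p - j) →
        IsUnit (Matrix.of fun a b : Fin (p - j) =>
          K ((S.equivFin.symm ⟨(a : ℕ), by rw [hS]; exact a.isLt⟩ : S) : Fin p)
            ⟨j + (b : ℕ), by omega⟩)) := by
  have key (j : ℕ) (hj : j < p) (S : Finset (Fin p)) (hS : S.card = p - j) :
      IsUnit (Matrix.of fun a b : Fin (p - j) =>
          K ((S.equivFin.symm ⟨(a : ℕ), by rw [hS]; exact a.isLt⟩ : S) : Fin p)
            ⟨j + (b : ℕ), by omega⟩) ↔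
      ∀ u u' : Fin p → ℝ, (∀ i : Fin p, (i : ℕ) < j → u i = u' i) →
        (∀ s ∈ S, (K *ᵥ u) s = (K *ᵥ u') s) → u = u' := by
    have hc : Function.Injective fun b : Fin (p - j) => (⟨j + (b : ℕ), by omega⟩ : Fin p) := by
      intro a b hab
      simpa [Fin.ext_iff] using hab
    refine (K.isUnit_submatrix_iff_recoverable
      (fun a : Fin (p - j) =>
        ((S.equivFin.symm ⟨(a : ℕ), by rw [hS]; exact a.isLt⟩ : S) : Fin p)) hc).trans ?_
    refine forall₂_congr fun u u' => imp_congr (forall_congr' fun i => imp_congr ?_ Iff.rfl)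
      (imp_congr ⟨fun h s hs => ?_, fun h k => h _ (Subtype.prop _)⟩ Iff.rfl)
    · refine ⟨fun hi => by_contra fun hij => hi ⟨⟨i - j, by omega⟩, ?_⟩, ?_⟩
      · ext
        exact Nat.add_sub_of_le (not_lt.1 hij)
      · rintro hi ⟨b, rfl⟩
        exact absurd hi (by simp)
    · have hlt : (S.equivFin ⟨s, hs⟩ : ℕ) < p - j := hS ▸ (S.equivFin ⟨s, hs⟩).isLt
      simpa using h ⟨S.equivFin ⟨s, hs⟩, hlt⟩
  constructor
  · intro h
    refine ⟨Matrix.mulVec_injective_iff_isUnit.1 fun u u' huu' => ?_,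
      fun j _ hj S hS => (key j hj S hS).2 (h j hj S hS)⟩
    exact h 0 hp Finset.univ (by simp) u u' (fun i hi => absurd hi (Nat.not_lt_zero _))
      fun s _ => congrFun huu' s
  · rintro ⟨hK, h⟩ j hj S hS
    obtain rfl | hj0 := Nat.eq_zero_or_pos j
    · intro u u' _ hu
      have hSuniv : S = Finset.univ := S.card_eq_iff_eq_univ.1 (by simpa using hS)
      exact Matrix.mulVec_injective_iff_isUnit.2 hK
        (funext fun s => hu s (hSuniv ▸ Finset.mem_univ s))
    · exact (key j hj S hS).1 (h j hj0 hj S hS)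
end

section
/- Let H_4 = [[1,1,1,1],[1,−1,1,−1],[1,1,−1,−1],[1,−1,−1,1]] and for u ∈ ℝ⁴ write y = H_4 u. Then: (a) u is uniquely determined by (y_1,y_2,y_3,y_4), but u_1 is NOT determined by any three of the four outputs: for every three-element subset S ⊂ {1,2,3,4} there exist u, u′ with u_1 ≠ u′_1 and (H_4 u)_s = (H_4 u′)_s for all s ∈ S; (b) given u_1, the input u_2 is uniquely determined by the pair (y_1,y_3) and also by the pair (y_2,y_4); (c) given u_1 and u_2, the input u_3 is uniquely determined by any pair (y_i,y_j) with i ∈ {1,3} and j ∈ {2,4}; (d) given u_1, u_2 and u_3, the input u_4 is uniquely determined by any single output y_i, i ∈ {1,2,3,4}. -/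
open scoped Matrix

/-- Recoverability structure of the 4×4 Sylvester–Hadamard kernel
(the recursive polarization structure of the size-4 construction, Lemma 3 of the paper).
Writing `y = H₄ u`:
(a) `u` is determined by all four outputs, but `u 0` is not determined by any three;
(b) given `u 0`, the input `u 1` is determined by `(y 0, y 2)` and also by `(y 1, y 3)`;
(c) given `u 0, u 1`, the input `u 2` is determined by any pair `(y i, y j)` with
    `i ∈ {0,2}`, `j ∈ {1,3}`;
(d) given `u 0, u 1, u 2`, the input `u 3` is determined by any single output. -/
theorem hadamard4_sequential_recoverability :
    let H : Matrix (Fin 4) (Fin 4) ℝ := !![1, 1, 1, 1; 1, -1, 1, -1; 1, 1, -1, -1; 1, -1, -1, 1]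
    -- (a)
    ((∀ u u' : Fin 4 → ℝ, H *ᵥ u = H *ᵥ u' → u = u') ∧
      (∀ S : Finset (Fin 4), S.card = 3 →
        ∃ u u' : Fin 4 → ℝ, u 0 ≠ u' 0 ∧ ∀ s ∈ S, (H *ᵥ u) s = (H *ᵥ u') s)) ∧
    -- (b)
    (∀ u u' : Fin 4 → ℝ, u 0 = u' 0 →
      (((H *ᵥ u) 0 = (H *ᵥ u') 0 ∧ (H *ᵥ u) 2 = (H *ᵥ u') 2) → u 1 = u' 1) ∧
      (((H *ᵥ u) 1 = (H *ᵥ u') 1 ∧ (H *ᵥ u) 3 = (H *ᵥ u') 3) → u 1 = u' 1)) ∧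
    -- (c)
    (∀ u u' : Fin 4 → ℝ, u 0 = u' 0 → u 1 = u' 1 →
      ∀ i ∈ ({0, 2} : Finset (Fin 4)), ∀ j ∈ ({1, 3} : Finset (Fin 4)),
        (H *ᵥ u) i = (H *ᵥ u') i → (H *ᵥ u) j = (H *ᵥ u') j → u 2 = u' 2) ∧
    -- (d)
    (∀ u u' : Fin 4 → ℝ, u 0 = u' 0 → u 1 = u' 1 → u 2 = u' 2 →
      ∀ i : Fin 4, (H *ᵥ u) i = (H *ᵥ u') i → u 3 = u' 3) := by
  intro H
  have h₀ (u : Fin 4 → ℝ) : (H *ᵥ u) 0 = u 0 + u 1 + u 2 + u 3 := by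
    simp [H, Matrix.mulVec, dotProduct, Fin.sum_univ_four]
  have h₁ (u : Fin 4 → ℝ) : (H *ᵥ u) 1 = u 0 - u 1 + u 2 - u 3 := by
    simp [H, Matrix.mulVec, dotProduct, Fin.sum_univ_four]
    ring
  have h₂ (u : Fin 4 → ℝ) : (H *ᵥ u) 2 = u 0 + u 1 - u 2 - u 3 := by
    simp [H, Matrix.mulVec, dotProduct, Fin.sum_univ_four]
    ring
  have h₃ (u : Fin 4 → ℝ) : (H *ᵥ u) 3 = u 0 - u 1 - u 2 + u 3 := by
    simp [H, Matrix.mulVec, dotProduct, Fin.sum_univ_four]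
    ring
  refine ⟨⟨fun u u' h => ?_, fun S hS => ?_⟩, fun u u' e₀ => ⟨?_, ?_⟩, ?_, ?_⟩
  · have k₀ := congrFun h 0
    have k₁ := congrFun h 1
    have k₂ := congrFun h 2
    have k₃ := congrFun h 3
    rw [h₀, h₀] at k₀
    rw [h₁, h₁] at k₁
    rw [h₂, h₂] at k₂
    rw [h₃, h₃] at k₃
    ext i
    fin_cases i <;> dsimp <;> linarith
  · obtain ⟨k, hk⟩ : ∃ k, k ∉ S := by
      by_contra! hall
      simp [Finset.eq_univ_iff_forall.mpr hall] at hS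
    -- The rows of `H` are pairwise orthogonal and start with `1`.
    refine ⟨H k, 0, ?_, fun s hs => ?_⟩
    · fin_cases k <;> simp [H]
    · have hsk : s ≠ k := fun h => hk (h ▸ hs)
      clear hk hs
      fin_cases k <;> fin_cases s <;> simp [h₀, h₁, h₂, h₃] at hsk ⊢ <;> simp [H]
  · rintro ⟨k₀, k₂⟩
    rw [h₀, h₀] at k₀
    rw [h₂, h₂] at k₂
    linarith
  · rintro ⟨k₁, k₃⟩
    rw [h₁, h₁] at k₁
    rw [h₃, h₃] at k₃
    linarith
  · intro u u' e₀ e₁ i hi j hj hyi hyj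
    simp only [Finset.mem_insert, Finset.mem_singleton] at hi hj
    rcases hi with rfl | rfl <;> rcases hj with rfl | rfl <;>
      simp only [h₀, h₁, h₂, h₃] at hyi hyj <;> linarith
  · intro u u' e₀ e₁ e₂ i hyi
    fin_cases i <;> simp only [Fin.zero_eta, Fin.mk_one, Fin.reduceFinMk, h₀, h₁, h₂, h₃] at hyi <;>
      linarith
end
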